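/- For every prime p and every n ≥ 1, the number of subgroups of ℤⁿ of index p^e equals the coefficient of X^e in ∏_{i=0}^{n−1} 1/(1 − pⁱX); equivalently, as an identity of formal power series in p^{−s}, ∑_{Λ ≤ ℤ_pⁿ, finite index} [ℤ_pⁿ : Λ]^{−s} = ∏_{i=0}^{n−1} 1/(1 − p^{i−s}). -/

import Mathlib

namespace SubgroupCount

variable {M : Type*} [AddCommGroup M]

/-- The submodule of `ℤ × M` generated by `0 × K` and `(d, x)`, where `x` is any lift of `c`. -/
def extend (d : ℕ) (K : Submodule ℤ M) (c : M ⧸ K) : Submodule ℤ (ℤ × M) where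
  carrier := {u | ∃ k : ℤ, u.1 = k * d ∧ K.mkQ u.2 = k • c}
  add_mem' := by
    rintro u v ⟨k, hk, hk'⟩ ⟨l, hl, hl'⟩
    refine ⟨k + l, ?_, ?_⟩
    · rw [Prod.fst_add, hk, hl, add_mul]
    · rw [Prod.snd_add, map_add, hk', hl', add_smul]
  zero_mem' := ⟨0, by simp, by simp⟩
  smul_mem' := by
    rintro a u ⟨k, hk, hk'⟩
    refine ⟨a * k, ?_, ?_⟩
    · rw [Prod.smul_fst, hk, smul_eq_mul, mul_assoc]
    · rw [Prod.smul_snd, map_smul, hk', mul_smul]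

lemma mem_extend {d : ℕ} {K : Submodule ℤ M} {c : M ⧸ K} {u : ℤ × M} :
    u ∈ extend d K c ↔ ∃ k : ℤ, u.1 = k * d ∧ K.mkQ u.2 = k • c := Iff.rfl

lemma zero_mk_mem_extend {d : ℕ} (hd : d ≠ 0) {K : Submodule ℤ M} {c : M ⧸ K} {y : M} :
    ((0 : ℤ), y) ∈ extend d K c ↔ y ∈ K := by
  rw [mem_extend]
  constructor
  · rintro ⟨k, hk, hk'⟩
    have : k = 0 := by simpa [hd] using hk
    subst this
    simpa using hk'
  · intro hy
    exact ⟨0, by simp, by simpa using hy⟩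

lemma mk_mem_extend {d : ℕ} {K : Submodule ℤ M} (x : M) :
    ((d : ℤ), x) ∈ extend d K (K.mkQ x) := ⟨1, by simp, by simp⟩

lemma dvd_of_extend_le {d d' : ℕ} {K K' : Submodule ℤ M} {c : M ⧸ K} {c' : M ⧸ K'}
    (h : extend d K c ≤ extend d' K' c') : d' ∣ d := by
  obtain ⟨x, rfl⟩ := K.mkQ_surjective c
  obtain ⟨k, hk, -⟩ := h (mk_mem_extend x)
  exact Int.natCast_dvd_natCast.1 ⟨k, by rw [mul_comm]; exact hk⟩

lemma extend_right_injective {d : ℕ} (hd : d ≠ 0) (K : Submodule ℤ M) :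
    Function.Injective (extend d K) := by
  intro c c' h
  obtain ⟨x, rfl⟩ := K.mkQ_surjective c
  have hx := mk_mem_extend (d := d) (K := K) x
  rw [h] at hx
  obtain ⟨k, hk, hk'⟩ := hx
  have hk1 : k = 1 := by
    have hd' : (d : ℤ) ≠ 0 := by exact_mod_cast hd
    exact (mul_right_cancel₀ hd' (by simpa using hk)).symm
  simpa [hk1] using hk'

lemma card_quotient_extend {d : ℕ} (hd : d ≠ 0) (K : Submodule ℤ M) (c : M ⧸ K) :
    Nat.card ((ℤ × M) ⧸ extend d K c) = d * Nat.card (M ⧸ K) := by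
  have : NeZero d := ⟨hd⟩
  have hd' : (d : ℤ) ≠ 0 := by exact_mod_cast hd
  let f : ℤ × M → ZMod d × (M ⧸ K) := fun u => ((u.1 : ZMod d), K.mkQ u.2 - (u.1 / d) • c)
  have hf : ∀ u v, f u = f v ↔ (QuotientAddGroup.leftRel (extend d K c).toAddSubgroup) u v := by
    intro u v
    rw [QuotientAddGroup.leftRel_apply, Submodule.mem_toAddSubgroup, mem_extend]
    simp only [f, Prod.mk.injEq, ZMod.intCast_eq_intCast_iff_dvd_sub, neg_add_eq_sub,
      Prod.fst_sub, Prod.snd_sub, map_sub]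
    have key : ∀ k : ℤ, v.1 - u.1 = k * d → v.1 / d = u.1 / d + k := by
      intro k hk
      rw [show v.1 = u.1 + k * d by linarith, Int.add_mul_ediv_right _ _ hd']
    constructor
    · rintro ⟨⟨k, hk⟩, h⟩
      rw [mul_comm] at hk
      refine ⟨k, hk, ?_⟩
      rw [key k hk, add_smul] at h
      rw [sub_eq_sub_iff_add_eq_add] at h
      rw [sub_eq_iff_eq_add]
      have := congrArg (· - (u.1 / (d : ℤ)) • c) h
      rw [show K.mkQ u.2 + ((u.1 / (d : ℤ)) • c + k • c) - (u.1 / (d : ℤ)) • c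
        = k • c + K.mkQ u.2 by abel, add_sub_cancel_right] at this
      exact this.symm
    · rintro ⟨k, hk, h⟩
      refine ⟨⟨k, by rw [hk, mul_comm]⟩, ?_⟩
      rw [key k hk, add_smul, sub_eq_iff_eq_add.1 h]
      abel
  have hsurj : Function.Surjective f := by
    rintro ⟨a, q⟩
    obtain ⟨z, rfl⟩ := ZMod.intCast_surjective a
    obtain ⟨x, hx⟩ := K.mkQ_surjective (q + (z / (d : ℤ)) • c)
    exact ⟨(z, x), by simp only [f, hx, add_sub_cancel_right]⟩
  have e : ((ℤ × M) ⧸ extend d K c) ≃ ZMod d × (M ⧸ K) :=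
    Equiv.ofBijective (Quotient.lift f fun u v h => (hf u v).2 h)
      ⟨by
        rintro ⟨u⟩ ⟨v⟩ h
        exact Quotient.sound ((hf u v).1 h),
       fun y => by
        obtain ⟨u, rfl⟩ := hsurj y
        exact ⟨Quotient.mk _ u, rfl⟩⟩
  rw [Nat.card_congr e, Nat.card_prod, Nat.card_zmod]

lemma exists_eq_extend (H : Submodule ℤ (ℤ × M)) (hH : Nat.card ((ℤ × M) ⧸ H) ≠ 0) :
    ∃ d : ℕ, d ≠ 0 ∧ ∃ (K : Submodule ℤ M) (c : M ⧸ K), H = extend d K c := by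
  obtain ⟨g, hg⟩ := (IsPrincipalIdealRing.principal (H.map (LinearMap.fst ℤ ℤ M))).principal
  have hg' : H.map (LinearMap.fst ℤ ℤ M) = Ideal.span {(g.natAbs : ℤ)} := by
    rw [Int.span_natAbs, hg]
  set d := g.natAbs
  have hmem : ∀ z : ℤ, (∃ x, (z, x) ∈ H) ↔ (d : ℤ) ∣ z := by
    intro z
    rw [← Ideal.mem_span_singleton, ← hg']
    simp
  refine ⟨d, ?_, H.comap (LinearMap.inr ℤ ℤ M), ?_⟩
  · intro hd
    have h := (hmem (Nat.card ((ℤ × M) ⧸ H))).1 ⟨0, by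
      have h1 : Nat.card ((ℤ × M) ⧸ H) • H.mkQ ((1 : ℤ), (0 : M)) = 0 := card_nsmul_eq_zero'
      rw [← map_nsmul, Submodule.mkQ_apply, Submodule.Quotient.mk_eq_zero] at h1
      simpa using h1⟩
    rw [hd, Nat.cast_zero, zero_dvd_iff, Nat.cast_eq_zero] at h
    exact hH h
  · obtain ⟨x, hx⟩ := (hmem d).2 dvd_rfl
    refine ⟨Submodule.mkQ _ x, ?_⟩
    have key : ∀ (k : ℤ) (y : M), ((k * d, y) ∈ H ↔
        y - k • x ∈ H.comap (LinearMap.inr ℤ ℤ M)) := by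
      intro k y
      rw [Submodule.mem_comap, ← Submodule.sub_mem_iff_left H (H.smul_mem k hx)]
      simp
    ext ⟨z, y⟩
    rw [mem_extend]
    simp only [← map_smul]
    constructor
    · intro h
      obtain ⟨k, rfl⟩ := (hmem z).1 ⟨y, h⟩
      rw [mul_comm] at h ⊢
      refine ⟨k, rfl, ?_⟩
      exact (Submodule.Quotient.eq _).2 ((key k y).1 h)
    · rintro ⟨k, rfl, h⟩
      exact (key k y).2 ((Submodule.Quotient.eq _).1 h)

variable (M) in
/-- The submodules of `M` of index `N`. -/
abbrev OfIndex (N : ℕ) : Type _ := {H : Submodule ℤ M // Nat.card (M ⧸ H) = N}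

/-- Transport of submodules of given index along a linear equivalence. -/
def OfIndex.congr {M' : Type*} [AddCommGroup M'] (f : M ≃ₗ[ℤ] M') (N : ℕ) :
    OfIndex M N ≃ OfIndex M' N :=
  (Submodule.orderIsoMapComap f).toEquiv.subtypeEquiv fun H => by
    rw [Nat.card_congr (Submodule.Quotient.equiv H _ f rfl).toEquiv]
    rfl

/-- `extend`, as a parametrization of the submodules of `ℤ × M` of index `p ^ e`. -/
def ofIndexProd {p : ℕ} (hp : p.Prime) (e : ℕ)
    (t : Σ j : Finset.HasAntidiagonal.antidiagonal e, Σ K : OfIndex M (p ^ j.1.2), M ⧸ K.1) :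
    OfIndex (ℤ × M) (p ^ e) :=
  ⟨extend (p ^ t.1.1.1) t.2.1.1 t.2.2, by
    rw [card_quotient_extend (pow_ne_zero _ hp.ne_zero), t.2.1.2, ← pow_add,
      Finset.HasAntidiagonal.mem_antidiagonal.1 t.1.2]⟩

lemma ofIndexProd_bijective {p : ℕ} (hp : p.Prime) (e : ℕ) :
    Function.Bijective (ofIndexProd (M := M) hp e) := by
  constructor
  · rintro ⟨⟨⟨a, b⟩, hab⟩, ⟨K, hK⟩, c⟩ ⟨⟨⟨a', b'⟩, hab'⟩, ⟨K', hK'⟩, c'⟩ h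
    have h : extend (p ^ a) K c = extend (p ^ a') K' c' := congrArg Subtype.val h
    obtain rfl : a = a' := Nat.pow_right_injective hp.two_le
      (Nat.dvd_antisymm (dvd_of_extend_le h.ge) (dvd_of_extend_le h.le))
    obtain rfl : b = b' := by
      rw [Finset.HasAntidiagonal.mem_antidiagonal] at hab hab'
      simp only at hab hab'
      omega
    have hd : p ^ a ≠ 0 := pow_ne_zero _ hp.ne_zero
    obtain rfl : K = K' := by
      ext y
      rw [← zero_mk_mem_extend hd (c := c), h, zero_mk_mem_extend hd]
    rw [extend_right_injective hd K h]
  · rintro ⟨H, hH⟩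
    obtain ⟨d, hd, K, c, rfl⟩ := exists_eq_extend H (by
      rw [hH]; exact pow_ne_zero _ hp.ne_zero)
    have hdK := hH
    rw [card_quotient_extend hd] at hdK
    obtain ⟨a, -, rfl⟩ := (Nat.dvd_prime_pow hp).1 (Dvd.intro _ hdK)
    obtain ⟨b, -, hb⟩ := (Nat.dvd_prime_pow hp).1 (Dvd.intro_left _ hdK)
    refine ⟨⟨⟨(a, b), ?_⟩, ⟨K, hb⟩, c⟩, rfl⟩
    rw [hb, ← pow_add] at hdK
    exact Finset.HasAntidiagonal.mem_antidiagonal.2 (Nat.pow_right_injective hp.two_le hdK)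

lemma finite_quotient_of_ofIndex {p : ℕ} (hp : p.Prime) {b : ℕ} (K : OfIndex M (p ^ b)) :
    Finite (M ⧸ K.1) :=
  Nat.finite_of_card_ne_zero (by rw [K.2]; exact pow_ne_zero _ hp.ne_zero)

lemma finite_ofIndex_prod {p : ℕ} (hp : p.Prime) (h : ∀ b, Finite (OfIndex M (p ^ b))) (e : ℕ) :
    Finite (OfIndex (ℤ × M) (p ^ e)) := by
  have := fun b (K : OfIndex M (p ^ b)) => finite_quotient_of_ofIndex hp K
  exact Finite.of_surjective _ (ofIndexProd_bijective hp e).surjective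

lemma card_ofIndex_prod {p : ℕ} (hp : p.Prime) (h : ∀ b, Finite (OfIndex M (p ^ b))) (e : ℕ) :
    Nat.card (OfIndex (ℤ × M) (p ^ e)) =
      ∑ j ∈ Finset.HasAntidiagonal.antidiagonal e, Nat.card (OfIndex M (p ^ j.2)) * p ^ j.2 := by
  have := fun b (K : OfIndex M (p ^ b)) => finite_quotient_of_ofIndex hp K
  have := fun b => Fintype.ofFinite (OfIndex M (p ^ b))
  rw [← Nat.card_congr (Equiv.ofBijective _ (ofIndexProd_bijective hp e)), Nat.card_sigma,
    ← Finset.sum_coe_sort (Finset.HasAntidiagonal.antidiagonal e) fun j =>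
      Nat.card (OfIndex M (p ^ j.2)) * p ^ j.2]
  refine Finset.sum_congr rfl fun j _ => ?_
  rw [Nat.card_sigma, Finset.sum_congr rfl fun K _ => K.2]
  simp

lemma sum_antidiagonalTuple_succ (p n e : ℕ) :
    ∑ t ∈ Finset.Nat.antidiagonalTuple (n + 1) e, ∏ i : Fin (n + 1), p ^ ((i : ℕ) * t i) =
      ∑ j ∈ Finset.HasAntidiagonal.antidiagonal e,
        (∑ t ∈ Finset.Nat.antidiagonalTuple n j.2, ∏ i : Fin n, p ^ ((i : ℕ) * t i)) * p ^ j.2 := by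
  simp only [Finset.sum_mul]
  rw [Finset.sum_sigma']
  refine Finset.sum_bij' (fun t _ => ⟨(t 0, ∑ i : Fin n, t i.succ), fun i => t i.succ⟩)
    (fun s _ => Fin.cons s.1.1 s.2) ?_ ?_ ?_ ?_ ?_
  · intro t ht
    rw [Finset.Nat.mem_antidiagonalTuple, Fin.sum_univ_succ] at ht
    simp [Finset.Nat.mem_antidiagonalTuple, ht]
  · rintro ⟨⟨a, b⟩, t⟩ h
    simp only [Finset.mem_sigma, Finset.HasAntidiagonal.mem_antidiagonal,
      Finset.Nat.mem_antidiagonalTuple] at h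
    simp [Finset.Nat.mem_antidiagonalTuple, Fin.sum_univ_succ, h.1, h.2]
  · intro t _
    exact Fin.cons_self_tail t
  · rintro ⟨⟨a, b⟩, t⟩ h
    simp only [Finset.mem_sigma, Finset.Nat.mem_antidiagonalTuple] at h
    simp [h.2]
  · intro t _
    rw [Fin.prod_univ_succ, ← Finset.prod_pow_eq_pow_sum, ← Finset.prod_mul_distrib]
    simp [add_mul, pow_add]

lemma ofIndex_pi {p : ℕ} (hp : p.Prime) (n : ℕ) : ∀ e,
    Finite (OfIndex (Fin n → ℤ) (p ^ e)) ∧ Nat.card (OfIndex (Fin n → ℤ) (p ^ e)) =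
      ∑ t ∈ Finset.Nat.antidiagonalTuple n e, ∏ i : Fin n, p ^ ((i : ℕ) * t i) := by
  induction n with
  | zero =>
    intro e
    refine ⟨inferInstance, ?_⟩
    have h1 (H : Submodule ℤ (Fin 0 → ℤ)) : Nat.card ((Fin 0 → ℤ) ⧸ H) = 1 := Nat.card_unique
    cases e with
    | zero =>
      have : Unique (OfIndex (Fin 0 → ℤ) (p ^ 0)) :=
        { default := ⟨⊥, h1 ⊥⟩, uniq := fun _ => Subsingleton.elim _ _ }
      rw [Nat.card_unique]
      simp
    | succ e =>
      have : IsEmpty (OfIndex (Fin 0 → ℤ) (p ^ (e + 1))) :=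
        ⟨fun H => (Nat.one_lt_pow e.succ_ne_zero hp.one_lt).ne ((h1 H.1).symm.trans H.2)⟩
      simp
  | succ n ih =>
    intro e
    have f := OfIndex.congr (Fin.consLinearEquiv ℤ fun _ : Fin (n + 1) => ℤ) (p ^ e)
    have hfin := finite_ofIndex_prod hp (fun b => (ih b).1) e
    refine ⟨Finite.of_equiv _ f, ?_⟩
    rw [← Nat.card_congr f, sum_antidiagonalTuple_succ]
    refine (card_ofIndex_prod hp (fun b => (ih b).1) e).trans ?_
    exact Finset.sum_congr rfl fun j _ => by rw [(ih j.2).2]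

end SubgroupCount

/-- For every prime `p`, `n ≥ 1` and `e ≥ 0`, the number of subgroups (`ℤ`-submodules) of
`ℤⁿ` of index `p^e` equals the coefficient of `Xᵉ` in `∏_{i=0}^{n−1} (1 − pⁱX)^{−1}`, i.e.
`∑_{e₀+⋯+e_{n−1}=e} p^{0·e₀+1·e₁+⋯+(n−1)·e_{n−1}}`.  (This is the local version of
`ζ_{ℤⁿ}(s) = ζ(s)ζ(s−1)⋯ζ(s−n+1)`.) -/
theorem stmt_18 (n : ℕ) (hn : 1 ≤ n) (p : ℕ) (hp : p.Prime) (e : ℕ) :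
    Nat.card {H : Submodule ℤ (Fin n → ℤ) // Nat.card ((Fin n → ℤ) ⧸ H) = p ^ e}
      = ∑ t ∈ Finset.Nat.antidiagonalTuple n e, ∏ i : Fin n, p ^ ((i : ℕ) * t i) := by
  exact (SubgroupCount.ofIndex_pi hp n e).2
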